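/- Let Γ be a group with a finite symmetric generating set S whose word balls satisfy |B(n)| ≤ C·n^d for all n ≥ 1, for some constants C > 0 and d ≥ 0, and let Γ act by homeomorphisms on a nonempty compact metrizable space X. Then for every closed subset A ⊆ X there exists a Γ-invariant Borel probability measure ν on X such that ν(A) ≥ limsup_{n→∞} sup_{x∈X} (1/|B(n)|)·∑_{g∈B(n)} 1_A(g·x). -/

import Mathlib

open MeasureTheory Filter Topology

/-- The word ball of radius `n` with respect to a generating set `S`:
elements expressible as a product of at most `n` elements of `S` (so `B 0 = {1}`). -/
def wordBall {Γ : Type*} [Group Γ] (S : Set Γ) (n : ℕ) : Set Γ :=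
  {g : Γ | ∃ l : List Γ, (∀ x ∈ l, x ∈ S) ∧ l.length ≤ n ∧ l.prod = g}

section WordBall

variable {Γ : Type*} [Group Γ] {S : Set Γ}

lemma one_mem_wordBall (n : ℕ) : (1 : Γ) ∈ wordBall S n :=
  ⟨[], by simp, by simp, rfl⟩

lemma wordBall_mono {m n : ℕ} (h : m ≤ n) : wordBall S m ⊆ wordBall S n :=
  fun _ ⟨l, hl, hlen, hp⟩ => ⟨l, hl, hlen.trans h, hp⟩

lemma mem_wordBall_one {s : Γ} (hs : s ∈ S) : s ∈ wordBall S 1 :=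
  ⟨[s], by simpa using hs, by simp, by simp⟩

lemma mul_mem_wordBall {m n : ℕ} {g h : Γ} (hg : g ∈ wordBall S m) (hh : h ∈ wordBall S n) :
    g * h ∈ wordBall S (m + n) := by
  obtain ⟨l, hl, hlen, rfl⟩ := hg
  obtain ⟨l', hl', hlen', rfl⟩ := hh
  refine ⟨l ++ l', fun x hx => ?_, by simpa using add_le_add hlen hlen', by simp⟩
  exact (List.mem_append.1 hx).elim (hl x) (hl' x)

lemma inv_mem_wordBall (hsym : S⁻¹ = S) {n : ℕ} {g : Γ} (hg : g ∈ wordBall S n) :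
    g⁻¹ ∈ wordBall S n := by
  obtain ⟨l, hl, hlen, rfl⟩ := hg
  refine ⟨(l.map (·⁻¹)).reverse, fun x hx => ?_, by simpa using hlen,
    (List.prod_inv_reverse l).symm⟩
  obtain ⟨y, hy, rfl⟩ := List.mem_map.1 (List.mem_reverse.1 hx)
  rw [← hsym]
  simpa using hl y hy

lemma exists_mul_eq_of_mem_wordBall_add {m n : ℕ} {g : Γ} (hg : g ∈ wordBall S (m + n)) :
    ∃ p ∈ wordBall S m, ∃ q ∈ wordBall S n, p * q = g := by
  obtain ⟨l, hl, hlen, rfl⟩ := hg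
  refine ⟨(l.take m).prod, ⟨l.take m, fun x hx => hl x (List.mem_of_mem_take hx), by simp, rfl⟩,
    (l.drop m).prod, ⟨l.drop m, fun x hx => hl x (List.mem_of_mem_drop hx), ?_, rfl⟩,
    List.prod_take_mul_prod_drop l m⟩
  simp only [List.length_drop]
  omega

lemma finite_wordBall (hfin : S.Finite) (n : ℕ) : (wordBall S n).Finite := by
  induction n with
  | zero =>
    refine (Set.finite_singleton (1 : Γ)).subset ?_
    rintro _ ⟨l, -, hlen, rfl⟩
    simp [List.length_eq_zero_iff.1 (Nat.le_zero.1 hlen)]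
  | succ n ih =>
    have h1 : (wordBall S 1).Finite := by
      refine (hfin.insert 1).subset ?_
      rintro _ ⟨l, hl, hlen, rfl⟩
      rcases l with _ | ⟨a, _ | ⟨b, l⟩⟩ <;> simp_all
    refine (Set.Finite.image2 (· * ·) ih h1).subset fun g hg => ?_
    obtain ⟨p, hp, q, hq, rfl⟩ := exists_mul_eq_of_mem_wordBall_add hg
    exact ⟨p, hp, q, hq, rfl⟩

lemma ncard_wordBall_pos (hfin : S.Finite) (n : ℕ) : 0 < (wordBall S n).ncard :=
  (Set.ncard_pos (finite_wordBall hfin n)).2 ⟨1, one_mem_wordBall n⟩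

lemma ncard_wordBall_mono (hfin : S.Finite) : Monotone fun n => (wordBall S n).ncard :=
  fun _ n h => Set.ncard_le_ncard (wordBall_mono h) (finite_wordBall hfin n)

/-- Counting the pairs of points at distance at most `3 * k`, one in the outer annulus of width `k`
of a ball and one in the annulus of width `3 * k` inside it. -/
lemma ncard_annulus_mul_le (hfin : S.Finite) (hsym : S⁻¹ = S) (m k : ℕ) :
    (wordBall S (m + 4 * k) \ wordBall S (m + 3 * k)).ncard * (wordBall S k).ncard ≤
      (wordBall S (m + 3 * k) \ wordBall S m).ncard * (wordBall S (3 * k)).ncard := by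
  classical
  have hO := (finite_wordBall hfin (m + 4 * k)).sdiff (t := wordBall S (m + 3 * k))
  have hI := (finite_wordBall hfin (m + 3 * k)).sdiff (t := wordBall S m)
  rw [Set.ncard_eq_toFinset_card _ hO, Set.ncard_eq_toFinset_card _ hI]
  refine Finset.card_mul_le_card_mul (fun g y => g⁻¹ * y ∈ wordBall S (3 * k)) ?_ ?_
  · intro g hg
    rw [Set.Finite.mem_toFinset] at hg
    obtain ⟨p, hp, q, hq, rfl⟩ := exists_mul_eq_of_mem_wordBall_add (m := m + 2 * k) (n := 2 * k)
      (wordBall_mono (by omega) hg.1)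
    rw [← Set.ncard_coe_finset]
    refine Set.ncard_le_ncard_of_injOn (p * ·) (fun r hr => ?_) (mul_right_injective p).injOn
      (Finset.finite_toSet _)
    simp only [Finset.coe_bipartiteAbove, Set.Finite.mem_toFinset, Set.mem_ofPred_eq, Set.mem_sdiff]
    refine ⟨⟨wordBall_mono (by omega) (mul_mem_wordBall hp hr), fun hpr => hg.2 ?_⟩, ?_⟩
    · have := mul_mem_wordBall hpr (mul_mem_wordBall (inv_mem_wordBall hsym hr) hq)
      rw [mul_assoc, mul_inv_cancel_left] at this
      exact wordBall_mono (by omega) this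
    · have := mul_mem_wordBall (inv_mem_wordBall hsym hq) hr
      rw [mul_inv_rev, mul_assoc, inv_mul_cancel_left]
      exact wordBall_mono (by omega) this
  · intro y _
    rw [← Set.ncard_coe_finset]
    refine Set.ncard_le_ncard_of_injOn (fun g => g⁻¹ * y) (fun g hg => ?_)
      (fun g _ h _ hgh => by simpa using hgh) (finite_wordBall hfin _)
    exact ((Finset.mem_bipartiteBelow _).1 (Finset.mem_coe.1 hg)).2

/-- Polynomial growth forces a uniform tripling bound at arbitrarily large scales. -/
lemma exists_ncard_wordBall_three_mul_le (hfin : S.Finite) {C d : ℝ} (hC : 0 < C)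
    (hpoly : ∀ n : ℕ, 1 ≤ n → ((wordBall S n).ncard : ℝ) ≤ C * (n : ℝ) ^ d) (k₀ : ℕ)
    (hk₀ : 1 ≤ k₀) :
    ∃ k, k₀ ≤ k ∧ (wordBall S (3 * k)).ncard ≤ 3 ^ (⌈d⌉₊ + 1) * (wordBall S k).ncard := by
  by_contra! hcon
  have hgrow : ∀ j : ℕ, (3 ^ (⌈d⌉₊ + 1)) ^ j ≤ (wordBall S (3 ^ j * k₀)).ncard := by
    intro j
    induction j with
    | zero => simpa using Nat.succ_le_of_lt (ncard_wordBall_pos hfin k₀)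
    | succ j ih =>
      have h := hcon (3 ^ j * k₀) (Nat.le_mul_of_pos_left _ (by positivity))
      rw [pow_succ', pow_succ' 3 j, mul_assoc 3]
      exact (Nat.mul_le_mul_left _ ih).trans h.le
  have hbound : ∀ j : ℕ, (3 : ℝ) ^ j ≤ C * (k₀ : ℝ) ^ ⌈d⌉₊ := by
    intro j
    have hn : 1 ≤ 3 ^ j * k₀ := Nat.mul_pos (by positivity) hk₀
    have h1 : ((3 : ℝ) ^ (⌈d⌉₊ + 1)) ^ j ≤ C * ((3 : ℝ) ^ j * k₀) ^ ⌈d⌉₊ := by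
      calc ((3 : ℝ) ^ (⌈d⌉₊ + 1)) ^ j ≤ ((wordBall S (3 ^ j * k₀)).ncard : ℝ) := by
            exact_mod_cast hgrow j
        _ ≤ C * ((3 ^ j * k₀ : ℕ) : ℝ) ^ d := hpoly _ hn
        _ ≤ C * ((3 ^ j * k₀ : ℕ) : ℝ) ^ (⌈d⌉₊ : ℝ) := by
            gcongr
            · exact_mod_cast hn
            · exact Nat.le_ceil d
        _ = C * ((3 : ℝ) ^ j * k₀) ^ ⌈d⌉₊ := by
            rw [Real.rpow_natCast]
            push_cast
            rfl
    have h2 : (0 : ℝ) < (3 ^ j) ^ ⌈d⌉₊ := by positivity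
    refine le_of_mul_le_mul_left ?_ h2
    calc ((3 : ℝ) ^ j) ^ ⌈d⌉₊ * 3 ^ j = (3 ^ (⌈d⌉₊ + 1)) ^ j := by ring
      _ ≤ _ := h1
      _ = _ := by ring
  obtain ⟨j, hj⟩ := pow_unbounded_of_one_lt (C * (k₀ : ℝ) ^ ⌈d⌉₊) (by norm_num : (1 : ℝ) < 3)
  exact (hj.trans_le (hbound j)).false

/-- In a group of polynomial growth the balls have asymptotically negligible spheres. -/
lemma tendsto_ncard_sphere_div_ncard_wordBall (hfin : S.Finite) (hsym : S⁻¹ = S) {C d : ℝ}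
    (hC : 0 < C)
    (hpoly : ∀ n : ℕ, 1 ≤ n → ((wordBall S n).ncard : ℝ) ≤ C * (n : ℝ) ^ d) :
    Tendsto (fun n : ℕ => (((wordBall S (n + 1)).ncard : ℝ) - (wordBall S n).ncard) /
      (wordBall S (n + 1)).ncard) atTop (𝓝 0) := by
  set b : ℕ → ℝ := fun n => ((wordBall S n).ncard : ℝ) with hb
  have hmono : Monotone b := fun m n h => by
    simpa [hb] using ncard_wordBall_mono hfin h
  have hpos : ∀ n, 0 < b n := fun n => by simpa [hb] using ncard_wordBall_pos hfin n
  set K : ℝ := 3 ^ (⌈d⌉₊ + 1) with hK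
  have hKpos : 0 < K := by positivity
  have hannulus : ∀ m k, b (3 * k) ≤ K * b k →
      b (m + 4 * k) - b (m + 3 * k) ≤ K / (1 + K) * (b (m + 4 * k) - b m) := by
    intro m k hk
    have hdiff : ∀ {i j : ℕ}, i ≤ j → ((wordBall S j \ wordBall S i).ncard : ℝ) = b j - b i := by
      intro i j hij
      rw [eq_sub_iff_add_eq]
      simp only [hb]
      exact_mod_cast Set.ncard_sdiff_add_ncard_of_subset (wordBall_mono hij)
        (finite_wordBall hfin j)
    have hcount : (b (m + 4 * k) - b (m + 3 * k)) * b k ≤ (b (m + 3 * k) - b m) * b (3 * k) := by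
      rw [← hdiff (by omega : m + 3 * k ≤ m + 4 * k), ← hdiff (by omega : m ≤ m + 3 * k)]
      simp only [hb]
      exact_mod_cast ncard_annulus_mul_le hfin hsym m k
    have hI : 0 ≤ b (m + 3 * k) - b m := sub_nonneg.2 (hmono (by omega))
    have hle : b (m + 4 * k) - b (m + 3 * k) ≤ K * (b (m + 3 * k) - b m) := by
      refine le_of_mul_le_mul_right (hcount.trans ?_) (hpos k)
      nlinarith [mul_le_mul_of_nonneg_left hk hI]
    rw [div_mul_eq_mul_div, le_div_iff₀ (by positivity)]
    linarith
  set θ : ℝ := K / (1 + K) with hθ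
  have hθ0 : 0 ≤ θ := by positivity
  have hθ1 : θ < 1 := (div_lt_one (by positivity)).2 (by linarith)
  have hiter : ∀ j : ℕ, ∃ k, ∀ m, b (m + k + 1) - b (m + k) ≤ θ ^ j * (b (m + k + 1) - b m) := by
    intro j
    induction j with
    | zero => exact ⟨0, fun m => by simp⟩
    | succ j ih =>
      obtain ⟨k, hk⟩ := ih
      obtain ⟨l, hkl, hl⟩ :=
        exists_ncard_wordBall_three_mul_le hfin hC hpoly (k + 1) (by omega)
      have hl' : b (3 * l) ≤ K * b l := by
        simp only [hb, hK]
        exact_mod_cast hl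
      refine ⟨4 * l - 1, fun m => ?_⟩
      have h1 := hk (m + 4 * l - (k + 1))
      rw [show m + 4 * l - (k + 1) + k + 1 = m + 4 * l by omega,
        show m + 4 * l - (k + 1) + k = m + (4 * l - 1) by omega] at h1
      rw [show m + (4 * l - 1) + 1 = m + 4 * l by omega]
      have h2 : b (m + 3 * l) ≤ b (m + 4 * l - (k + 1)) := hmono (by omega)
      calc b (m + 4 * l) - b (m + (4 * l - 1))
          ≤ θ ^ j * (b (m + 4 * l) - b (m + 4 * l - (k + 1))) := h1
        _ ≤ θ ^ j * (b (m + 4 * l) - b (m + 3 * l)) := by gcongr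
        _ ≤ θ ^ j * (θ * (b (m + 4 * l) - b m)) := by gcongr; exact hannulus m l hl'
        _ = θ ^ (j + 1) * (b (m + 4 * l) - b m) := by ring
  refine tendsto_order.2 ⟨fun a ha => Eventually.of_forall fun n => ha.trans_le
    (div_nonneg (sub_nonneg.2 (hmono n.le_succ)) (hpos _).le), fun ε hε => ?_⟩
  obtain ⟨j, hj⟩ := exists_pow_lt_of_lt_one hε hθ1
  obtain ⟨k, hk⟩ := hiter j
  filter_upwards [eventually_ge_atTop k] with n hn
  obtain ⟨m, rfl⟩ := Nat.exists_eq_add_of_le' hn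
  refine lt_of_le_of_lt ((div_le_iff₀ (hpos _)).2 ?_) hj
  refine (hk m).trans (mul_le_mul_of_nonneg_left ?_ (by positivity))
  linarith [hpos m]

end WordBall

lemma abs_sum_sub_sum_le_of_subset {ι : Type*} [DecidableEq ι] {E F G : Finset ι} (hF : E ⊆ F)
    (hG : E ⊆ G) {f : ι → ℝ} {M : ℝ} (hf : ∀ i, |f i| ≤ M) :
    |∑ i ∈ F, f i - ∑ i ∈ G, f i| ≤
      M * (((F.card : ℝ) - E.card) + ((G.card : ℝ) - E.card)) := by
  have hbound : ∀ {H : Finset ι}, E ⊆ H → |∑ i ∈ H \ E, f i| ≤ M * ((H.card : ℝ) - E.card) := by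
    intro H hH
    rw [← Finset.cast_card_sdiff hH, mul_comm, ← nsmul_eq_mul]
    exact (Finset.abs_sum_le_sum_abs _ _).trans (Finset.sum_le_card_nsmul _ _ _ fun i _ => hf i)
  rw [← Finset.sum_sdiff hF, ← Finset.sum_sdiff hG, add_sub_add_right_eq_sub, mul_add]
  exact (abs_sub _ _).trans (add_le_add (hbound hF) (hbound hG))

lemma abs_sum_wordBall_mul_sub_sum_le {Γ : Type*} [Group Γ] {S : Set Γ} (hfin : S.Finite)
    (hsym : S⁻¹ = S) {s : Γ} (hs : s ∈ S) {f : Γ → ℝ} {M : ℝ} (hf : ∀ g, |f g| ≤ M) (n : ℕ) :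
    |∑ g ∈ (finite_wordBall hfin (n + 1)).toFinset, f (s * g) -
        ∑ g ∈ (finite_wordBall hfin (n + 1)).toFinset, f g| ≤
      2 * M * (((wordBall S (n + 1)).ncard : ℝ) - (wordBall S n).ncard) := by
  classical
  have hsub : (finite_wordBall hfin n).toFinset ⊆ (finite_wordBall hfin (n + 1)).toFinset :=
    Set.Finite.toFinset_mono (wordBall_mono n.le_succ)
  have hsub' : (finite_wordBall hfin n).toFinset ⊆
      (finite_wordBall hfin (n + 1)).toFinset.map (mulLeftEmbedding s) := by
    intro g hg
    rw [Set.Finite.mem_toFinset] at hg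
    refine Finset.mem_map.2 ⟨s⁻¹ * g, (Set.Finite.mem_toFinset _).2 ?_, by simp⟩
    rw [add_comm]
    exact mul_mem_wordBall (inv_mem_wordBall hsym (mem_wordBall_one hs)) hg
  have h := abs_sum_sub_sum_le_of_subset hsub' hsub hf
  rw [Finset.sum_map, Finset.card_map,
    ← Set.ncard_eq_toFinset_card _ (finite_wordBall hfin (n + 1)),
    ← Set.ncard_eq_toFinset_card _ (finite_wordBall hfin n)] at h
  simp only [mulLeftEmbedding_apply] at h
  linarith

section OrbitAverage

variable {Γ X : Type*} [Group Γ] [MulAction Γ X] [MeasurableSpace X]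

/-- The uniform average of the Dirac masses at the points `g • x`, for `g ∈ F`. -/
noncomputable def orbitAverage (F : Finset Γ) (x : X) : Measure X :=
  (F.card : ENNReal)⁻¹ • ∑ g ∈ F, Measure.dirac (g • x)

lemma isProbabilityMeasure_orbitAverage {F : Finset Γ} (hF : F.Nonempty) (x : X) :
    IsProbabilityMeasure (orbitAverage F x) := by
  constructor
  simp only [orbitAverage, Measure.smul_apply, Measure.finsetSum_apply, measure_univ,
    Finset.sum_const, nsmul_eq_mul, mul_one, smul_eq_mul]
  exact ENNReal.inv_mul_cancel (by simpa using hF.ne_empty) (ENNReal.natCast_ne_top _)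

lemma integral_orbitAverage {f : X → ℝ} (hf : StronglyMeasurable f) (F : Finset Γ)
    (x : X) : ∫ y, f y ∂(orbitAverage F x) = (F.card : ℝ)⁻¹ * ∑ g ∈ F, f (g • x) := by
  rw [orbitAverage, integral_smul_measure, integral_finsetSum_measure]
  · simp [integral_dirac' _ _ hf]
  · exact fun g _ => integrable_dirac' hf (by simp)

lemma orbitAverage_real_apply {A : Set X} (hA : MeasurableSet A) (F : Finset Γ) (x : X) :
    (orbitAverage F x).real A =
      (F.card : ℝ)⁻¹ * ∑ g ∈ F, A.indicator (fun _ => (1 : ℝ)) (g • x) := by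
  rw [← integral_orbitAverage (stronglyMeasurable_const.indicator hA), integral_indicator hA]
  simp

end OrbitAverage

/-- A weak limit of averages over larger and larger balls of a group of polynomial growth is
invariant. -/
lemma map_smul_eq_of_tendsto_orbitAverage {Γ : Type*} [Group Γ]
    {S : Set Γ} (hfin : S.Finite) (hsym : S⁻¹ = S) (hgen : Subgroup.closure S = ⊤)
    {C d : ℝ} (hC : 0 < C)
    (hpoly : ∀ n : ℕ, 1 ≤ n → ((wordBall S n).ncard : ℝ) ≤ C * (n : ℝ) ^ d)
    {X : Type*} [TopologicalSpace X] [HasOuterApproxClosed X] [MeasurableSpace X] [BorelSpace X]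
    [MulAction Γ X] (hcont : ∀ g : Γ, Continuous fun x : X => g • x)
    {ι : Type*} {L : Filter ι} [L.NeBot] {r : ι → ℕ} (hr : Tendsto r L atTop) (x : ι → X)
    (μ : ι → ProbabilityMeasure X)
    (hμ : ∀ i, (μ i : Measure X) = orbitAverage (finite_wordBall hfin (r i)).toFinset (x i))
    {ν : ProbabilityMeasure X} (hν : Tendsto μ L (𝓝 ν)) (g : Γ) :
    Measure.map (fun x : X => g • x) (ν : Measure X) = ν := by
  have hmeas : ∀ g : Γ, Measurable fun x : X => g • x := fun g => (hcont g).measurable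
  have hgS : g ∈ Subgroup.closure S := hgen ▸ Subgroup.mem_top g
  induction hgS using Subgroup.closure_induction with
  | one => simp
  | mul a b _ _ ha hb =>
    have hab : (fun x : X => (a * b) • x) = (fun x : X => a • x) ∘ fun x : X => b • x :=
      funext fun x => mul_smul a b x
    rw [hab, ← Measure.map_map (hmeas a) (hmeas b), hb, ha]
  | inv a _ ha =>
    conv_lhs => rw [← ha]
    rw [Measure.map_map (hmeas _) (hmeas _)]
    simp [Function.comp_def]
  | mem s hs =>
    have : IsProbabilityMeasure (Measure.map (fun x : X => s • x) (ν : Measure X)) :=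
      Measure.isProbabilityMeasure_map (hmeas s).aemeasurable
    refine ext_of_forall_integral_eq_of_IsFiniteMeasure fun f => ?_
    rw [integral_map (hmeas s).aemeasurable f.continuous.aestronglyMeasurable]
    have hlim := ProbabilityMeasure.tendsto_iff_forall_integral_tendsto.1 hν
    have hdiff := (hlim (f.compContinuous ⟨_, hcont s⟩)).sub (hlim f)
    refine sub_eq_zero.1 (tendsto_nhds_unique hdiff ?_)
    have hsphere := (tendsto_ncard_sphere_div_ncard_wordBall hfin hsym hC hpoly).comp
      ((tendsto_sub_atTop_nat 1).comp hr)
    refine squeeze_zero_norm' ?_ (by simpa using hsphere.const_mul (2 * ‖f‖))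
    filter_upwards [hr.eventually_ge_atTop 1] with i hi
    have hi' : r i - 1 + 1 = r i := by omega
    have hsum := abs_sum_wordBall_mul_sub_sum_le hfin hsym hs (f := fun g => f (g • x i))
      (fun g => f.norm_coe_le_norm _) (r i - 1)
    simp only [hi'] at hsum ⊢
    rw [hμ, integral_orbitAverage (f.compContinuous ⟨_, hcont s⟩).continuous.stronglyMeasurable,
      integral_orbitAverage f.continuous.stronglyMeasurable,
      ← Set.ncard_eq_toFinset_card _ (finite_wordBall hfin (r i)), ← mul_sub,
      Real.norm_eq_abs, abs_mul, abs_of_nonneg (by positivity), inv_mul_eq_div, ← mul_div_assoc]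
    simp only [mul_smul] at hsum
    exact div_le_div_of_nonneg_right hsum (by positivity)

/-- For an action of a group of polynomial growth on a nonempty compact
metrizable space, the upper Banach density of a closed set is dominated by its measure
under some invariant Borel probability measure. -/
theorem exists_invariant_measure_ge_upper_density {Γ : Type*} [Group Γ]
    (S : Set Γ) (hfin : S.Finite) (hsym : S⁻¹ = S) (hgen : Subgroup.closure S = ⊤)
    (C d : ℝ) (hC : 0 < C) (hd : 0 ≤ d)
    (hpoly : ∀ n : ℕ, 1 ≤ n → ((wordBall S n).ncard : ℝ) ≤ C * (n : ℝ) ^ d)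
    {X : Type*} [TopologicalSpace X] [CompactSpace X]
    [TopologicalSpace.MetrizableSpace X] [Nonempty X]
    [MeasurableSpace X] [BorelSpace X]
    [MulAction Γ X] (hcont : ∀ g : Γ, Continuous fun x : X => g • x)
    (A : Set X) (hA : IsClosed A) :
    ∃ ν : Measure X, IsProbabilityMeasure ν ∧
      (∀ g : Γ, Measure.map (fun x : X => g • x) ν = ν) ∧
      Filter.limsup (fun n : ℕ =>
          ⨆ x : X, (1 / ((wordBall S n).ncard : ℝ)) *
            ∑ᶠ g ∈ wordBall S n, A.indicator (fun _ => (1 : ℝ)) (g • x)) atTop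
        ≤ (ν A).toReal := by
  have hnonempty : ∀ n, (finite_wordBall hfin n).toFinset.Nonempty := fun n =>
    (finite_wordBall hfin n).toFinset_nonempty.2 ⟨1, one_mem_wordBall n⟩
  let avg : ℕ → X → ProbabilityMeasure X := fun n x =>
    ⟨orbitAverage (finite_wordBall hfin n).toFinset x,
      isProbabilityMeasure_orbitAverage (hnonempty n) x⟩
  have havg : ∀ n x, (1 / ((wordBall S n).ncard : ℝ)) *
      ∑ᶠ g ∈ wordBall S n, A.indicator (fun _ => (1 : ℝ)) (g • x) =
        (avg n x : Measure X).real A := fun n x => by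
    rw [finsum_mem_eq_finite_toFinset_sum _ (finite_wordBall hfin n), one_div,
      Set.ncard_eq_toFinset_card _ (finite_wordBall hfin n)]
    exact (orbitAverage_real_apply hA.measurableSet _ x).symm
  simp only [havg]
  set D : ℝ := limsup (fun n => ⨆ x, (avg n x : Measure X).real A) atTop with hD
  have hfreq : ∀ k : ℕ, ∃ᶠ n in atTop, ∃ x, D - 1 / (k + 1 : ℝ) < (avg n x : Measure X).real A := by
    intro k
    have hlt : D - 1 / (k + 1 : ℝ) < D := sub_lt_self _ (by positivity)
    refine (frequently_lt_of_lt_limsup (isCoboundedUnder_le_of_le atTop (x := 0) fun n =>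
      Real.iSup_nonneg fun x => measureReal_nonneg) hlt).mono fun n hn => ?_
    exact exists_lt_of_lt_ciSup hn
  obtain ⟨r, hr, hx⟩ := extraction_forall_of_frequently hfreq
  choose x hx using hx
  let μ : ℕ → ProbabilityMeasure X := fun k => avg (r k) (x k)
  let U : Ultrafilter ℕ := Ultrafilter.of atTop
  have hU : (U : Filter ℕ) ≤ atTop := Ultrafilter.of_le atTop
  obtain ⟨ν, -, hν⟩ := isCompact_univ.ultrafilter_le_nhds (U.map μ) (by simp)
  have hν : Tendsto μ U (𝓝 ν) := hν
  refine ⟨ν, inferInstance, map_smul_eq_of_tendsto_orbitAverage hfin hsym hgen hC hpoly hcont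
    (hr.tendsto_atTop.mono_left hU) x μ (fun _ => rfl) hν, ?_⟩
  refine le_of_forall_pos_sub_le fun ε hε => ?_
  have hlarge : ∀ᶠ k in (U : Filter ℕ), ENNReal.ofReal (D - ε) ≤ (μ k : Measure X) A := by
    filter_upwards [hU ((tendsto_one_div_add_atTop_nhds_zero_nat (𝕜 := ℝ)).eventually_lt_const hε)]
      with k hk
    rw [← ofReal_measureReal]
    exact ENNReal.ofReal_le_ofReal (by linarith [hx k, show 1 / ((k : ℝ) + 1) < ε from hk])
  have hle : ENNReal.ofReal (D - ε) ≤ (ν : Measure X) A :=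
    (le_limsup_of_frequently_le' hlarge.frequently).trans
      (ProbabilityMeasure.limsup_measure_closed_le_of_tendsto hν hA)
  exact (ENNReal.ofReal_le_iff_le_toReal (measure_ne_top _ _)).1 hle
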